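/- arXiv:2605.24504 — 2 statements merged into one kernel-verified Lean document; each statement's English description precedes it below -/
import Mathlib

section
/- Let 𝒳 be a set and σ : 𝒳 → 𝒳 a confined self-map with growth rate Λ = 1, and suppose the dynamical zeta function ζ_σ(z) = exp(Σ_{k≥1} σ_k z^k/k) is a rational function. Then the sequence (σ_k) is periodic; if ϖ denotes its period, then: (i) B := (1/ϖ) Σ_{k=1}^{ϖ} σ_k is a positive integer and equals the Cesàro mean 𝒞(σ_k); (ii) P_ℓ = 0 unless ℓ divides ϖ, so the set of prime orbits is finite, and Σ_{ℓ ∣ ϖ} P_ℓ = B (the total number of prime orbits is B); (iii) M_σ(X) = B for all X > ϖ. -/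
open Filter Topology Real MeasureTheory Asymptotics
open scoped Classical

noncomputable section

/-- `σ` is confined: every iterate has only finitely many fixed points. -/
def Confined {𝒳 : Type*} (σ : 𝒳 → 𝒳) : Prop :=
  ∀ k : ℕ, 1 ≤ k → {x : 𝒳 | σ^[k] x = x}.Finite

/-- `σ_k`: the number of fixed points of the `k`-th iterate of `σ`. -/
def fixCount {𝒳 : Type*} (σ : 𝒳 → 𝒳) (k : ℕ) : ℕ :=
  Nat.card {x : 𝒳 // σ^[k] x = x}

/-- A prime orbit: a finite set of the form `{x, σ x, …, σ^[ℓ-1] x}` of cardinality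
exactly `ℓ ≥ 1`, mapped to itself by `σ`. -/
def IsPrimeOrbit {𝒳 : Type*} (σ : 𝒳 → 𝒳) (P : Set 𝒳) : Prop :=
  ∃ (x : 𝒳) (ℓ : ℕ), 0 < ℓ ∧ P = (fun i => σ^[i] x) '' Set.Iio ℓ ∧ P.ncard = ℓ ∧ σ '' P = P

/-- The type of prime orbits of `σ`. -/
def PrimeOrbit {𝒳 : Type*} (σ : 𝒳 → 𝒳) := {P : Set 𝒳 // IsPrimeOrbit σ P}

/-- The length `ℓ(P)` of a prime orbit. -/
def orbitLen {𝒳 : Type*} {σ : 𝒳 → 𝒳} (P : PrimeOrbit σ) : ℕ := P.1.ncard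

/-- General orbits: elements of the free abelian monoid on the prime orbits,
i.e. finitely supported multisets of prime orbits. -/
abbrev GenOrbit {𝒳 : Type*} (σ : 𝒳 → 𝒳) := PrimeOrbit σ →₀ ℕ

/-- The length of a general orbit: sum of the lengths of its prime components,
with multiplicity. -/
def genLen {𝒳 : Type*} {σ : 𝒳 → 𝒳} (O : GenOrbit σ) : ℕ :=
  O.sum fun P m => m * orbitLen P

/-- `N_σ(X)`: the number of general orbits of length at most `X`. -/
def Ncount {𝒳 : Type*} (σ : 𝒳 → 𝒳) (X : ℕ) : ℕ :=
  Nat.card {O : GenOrbit σ // genLen O ≤ X}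

/-- `P_ℓ`: the number of prime orbits of length `ℓ`. -/
def Pcount {𝒳 : Type*} (σ : 𝒳 → 𝒳) (ℓ : ℕ) : ℕ :=
  Nat.card {P : PrimeOrbit σ // orbitLen P = ℓ}

/-- The Mertens-type counting function `M_σ(X) = Σ_{1 ≤ ℓ ≤ X} P_ℓ Λ^{-ℓ}`. -/
def Mfun {𝒳 : Type*} (σ : 𝒳 → 𝒳) (Λ : ℝ) (X : ℕ) : ℝ :=
  ∑ ℓ ∈ Finset.Icc 1 X, (Pcount σ ℓ : ℝ) / Λ ^ ℓ

/-- The Cesàro mean of the real sequence `a` (indexed from `1`) equals `B`. -/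
def CesaroLim (a : ℕ → ℝ) (B : ℝ) : Prop :=
  Tendsto (fun X : ℕ => (∑ k ∈ Finset.Icc 1 X, a k) / (X : ℝ)) atTop (𝓝 B)

/-- Extended-real logarithm, sending `0` (and negative numbers) to `-∞`. -/
def elog (x : ℝ) : EReal := if x ≤ 0 then ⊥ else ((Real.log x : ℝ) : EReal)

/-- The sequence `log(σ_k)/k`, with values in the extended reals
(so that `σ_k = 0` contributes `-∞`). -/
def growthSeq {𝒳 : Type*} (σ : 𝒳 → 𝒳) (k : ℕ) : EReal :=
  elog (fixCount σ k) * ((((k : ℝ)⁻¹ : ℝ)) : EReal)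

/-- The growth rate of `σ` is the (finite) real number `Λ`, i.e.
`limsup_{k→∞} log(σ_k)/k = log Λ` in the extended reals. -/
def GrowthEq {𝒳 : Type*} (σ : 𝒳 → 𝒳) (Λ : ℝ) : Prop :=
  Filter.limsup (growthSeq σ) atTop = ((Real.log Λ : ℝ) : EReal)

/-- The probability that a uniformly chosen general orbit of length at most `X`
satisfies the predicate `Q`. -/
def probN {𝒳 : Type*} (σ : 𝒳 → 𝒳) (X : ℕ) (Q : GenOrbit σ → Prop) : ℝ :=
  (Nat.card {O : GenOrbit σ // genLen O ≤ X ∧ Q O} : ℝ) / (Ncount σ X : ℝ)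

/-- `ω(O)`: the number of distinct prime orbits dividing the general orbit `O`. -/
def omegaCount {𝒳 : Type*} {σ : 𝒳 → 𝒳} (O : GenOrbit σ) : ℕ := O.support.card

section Orbits

variable {𝒳 : Type*} {σ : 𝒳 → 𝒳}

theorem setOf_mem_periodicOrbit (x : 𝒳) :
    {y | y ∈ Function.periodicOrbit σ x} =
      (fun i => σ^[i] x) '' Set.Iio (Function.minimalPeriod σ x) := by
  ext y
  simp [Function.periodicOrbit_def, Cycle.mem_coe_iff, eq_comm]

theorem ncard_setOf_mem_periodicOrbit (x : 𝒳) :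
    {y | y ∈ Function.periodicOrbit σ x}.ncard = Function.minimalPeriod σ x := by
  rw [setOf_mem_periodicOrbit, Set.InjOn.ncard_image, Set.ncard_eq_toFinset_card']
  · simp
  · intro m hm n hn h
    exact (Function.iterate_eq_iterate_iff_of_lt_minimalPeriod hm hn).1 h

theorem isPrimeOrbit_of_mem_periodicPts {x : 𝒳} (hx : x ∈ Function.periodicPts σ) :
    IsPrimeOrbit σ {y | y ∈ Function.periodicOrbit σ x} := by
  have hpos := Function.minimalPeriod_pos_of_mem_periodicPts hx
  refine ⟨x, Function.minimalPeriod σ x, hpos, setOf_mem_periodicOrbit x,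
    ncard_setOf_mem_periodicOrbit x, ?_⟩
  ext y
  simp only [Set.mem_image, Set.mem_ofPred_eq, Function.mem_periodicOrbit_iff hx]
  constructor
  · rintro ⟨_, ⟨n, rfl⟩, rfl⟩
    exact ⟨n + 1, Function.iterate_succ_apply' σ n x⟩
  · rintro ⟨n, rfl⟩
    refine ⟨_, ⟨n + (Function.minimalPeriod σ x - 1), rfl⟩, ?_⟩
    rw [← Function.iterate_succ_apply' σ, Nat.succ_eq_add_one, add_assoc,
      Nat.sub_add_cancel hpos, Function.iterate_add_apply, Function.iterate_minimalPeriod]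

theorem IsPrimeOrbit.exists_eq_periodicOrbit {P : Set 𝒳} (hP : IsPrimeOrbit σ P) :
    ∃ x ∈ Function.periodicPts σ, P = {y | y ∈ Function.periodicOrbit σ x} := by
  obtain ⟨x, ℓ, hℓ, hPx, hcard, hσP⟩ := hP
  have hinj : Set.InjOn (fun i => σ^[i] x) (Set.Iio ℓ) := by
    rw [← Set.ncard_image_iff, ← hPx, hcard, Set.ncard_eq_toFinset_card']
    simp
  have hx : x ∈ σ '' P := by
    rw [hσP, hPx]
    exact ⟨0, hℓ, rfl⟩
  rw [hPx] at hx
  obtain ⟨_, ⟨i, hi, rfl⟩, hix⟩ := hx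
  have hi' : i < ℓ := hi
  have hper : σ^[i + 1] x = x := by
    rw [Function.iterate_succ_apply']
    exact hix
  have hiℓ : i + 1 = ℓ := by
    by_contra hne
    have := hinj (Set.mem_Iio.2 (by omega : i + 1 < ℓ)) (Set.mem_Iio.2 hℓ) hper
    omega
  have hmem : x ∈ Function.periodicPts σ := Function.mk_mem_periodicPts i.succ_pos hper
  refine ⟨x, hmem, ?_⟩
  ext y
  simp only [Set.mem_ofPred_eq, Function.mem_periodicOrbit_iff hmem, hPx]
  constructor
  · rintro ⟨n, -, rfl⟩
    exact ⟨n, rfl⟩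
  · rintro ⟨n, rfl⟩
    refine ⟨n % ℓ, Nat.mod_lt _ hℓ, ?_⟩
    have : Function.IsPeriodicPt σ ℓ x := hiℓ ▸ hper
    exact this.iterate_mod_apply n

theorem IsPrimeOrbit.eq_periodicOrbit_of_mem {P : Set 𝒳} (hP : IsPrimeOrbit σ P) {x : 𝒳}
    (hx : x ∈ P) :
    x ∈ Function.periodicPts σ ∧ P = {y | y ∈ Function.periodicOrbit σ x} := by
  obtain ⟨y, hy, rfl⟩ := hP.exists_eq_periodicOrbit
  obtain ⟨n, rfl⟩ := (Function.mem_periodicOrbit_iff hy).1 hx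
  refine ⟨?_, by rw [Function.periodicOrbit_apply_iterate_eq hy]⟩
  rw [← Function.minimalPeriod_pos_iff_mem_periodicPts, Function.minimalPeriod_apply_iterate hy]
  exact Function.minimalPeriod_pos_of_mem_periodicPts hy

theorem IsPrimeOrbit.ncard_pos {P : Set 𝒳} (hP : IsPrimeOrbit σ P) : 0 < P.ncard := by
  obtain ⟨_, _, hℓ, -, hcard, -⟩ := hP
  omega

theorem orbitLen_pos (P : PrimeOrbit σ) : 0 < orbitLen P := P.2.ncard_pos

theorem finite_primeOrbit_coe (P : PrimeOrbit σ) : P.1.Finite :=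
  Set.finite_of_ncard_pos P.2.ncard_pos

theorem orbitLen_eq_minimalPeriod (P : PrimeOrbit σ) {x : 𝒳} (hx : x ∈ P.1) :
    orbitLen P = Function.minimalPeriod σ x := by
  rw [orbitLen, (P.2.eq_periodicOrbit_of_mem hx).2, ncard_setOf_mem_periodicOrbit]

theorem iterate_eq_self_iff_orbitLen_dvd (P : PrimeOrbit σ) {x : 𝒳} (hx : x ∈ P.1) (k : ℕ) :
    σ^[k] x = x ↔ orbitLen P ∣ k := by
  rw [orbitLen_eq_minimalPeriod P hx]
  exact Function.isPeriodicPt_iff_minimalPeriod_dvd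

theorem exists_primeOrbit_mem {k : ℕ} (hk : 1 ≤ k) {x : 𝒳} (hx : σ^[k] x = x) :
    ∃ P : PrimeOrbit σ, x ∈ P.1 := by
  have hper : x ∈ Function.periodicPts σ := Function.mk_mem_periodicPts hk hx
  exact ⟨⟨_, isPrimeOrbit_of_mem_periodicPts hper⟩, Function.self_mem_periodicOrbit hper⟩

theorem primeOrbit_eq_of_mem {P Q : PrimeOrbit σ} {x : 𝒳} (hP : x ∈ P.1) (hQ : x ∈ Q.1) :
    P = Q :=
  Subtype.ext ((P.2.eq_periodicOrbit_of_mem hP).2.trans (Q.2.eq_periodicOrbit_of_mem hQ).2.symm)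

/-- The union of the prime orbits in `T` whose length divides `k`. -/
def orbitUnion (T : Finset (PrimeOrbit σ)) (k : ℕ) : Finset 𝒳 :=
  (T.filter fun P => orbitLen P ∣ k).biUnion fun P => (finite_primeOrbit_coe P).toFinset

theorem mem_orbitUnion {T : Finset (PrimeOrbit σ)} {k : ℕ} {x : 𝒳} :
    x ∈ orbitUnion T k ↔ ∃ P ∈ T, x ∈ P.1 ∧ σ^[k] x = x := by
  simp only [orbitUnion, Finset.mem_biUnion, Finset.mem_filter, Set.Finite.mem_toFinset]
  constructor
  · rintro ⟨P, ⟨hPT, hk⟩, hx⟩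
    exact ⟨P, hPT, hx, (iterate_eq_self_iff_orbitLen_dvd P hx k).2 hk⟩
  · rintro ⟨P, hPT, hx, hk⟩
    exact ⟨P, ⟨hPT, (iterate_eq_self_iff_orbitLen_dvd P hx k).1 hk⟩, hx⟩

theorem card_orbitUnion (T : Finset (PrimeOrbit σ)) (k : ℕ) :
    (orbitUnion T k).card = ∑ P ∈ T, if orbitLen P ∣ k then orbitLen P else 0 := by
  rw [orbitUnion, Finset.card_biUnion, Finset.sum_filter]
  · simp only [← Set.ncard_eq_toFinset_card]
    rfl
  · intro P _ Q _ hPQ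
    rw [Function.onFun, Finset.disjoint_left]
    intro x hxP hxQ
    exact hPQ (primeOrbit_eq_of_mem ((Set.Finite.mem_toFinset _).1 hxP)
      ((Set.Finite.mem_toFinset _).1 hxQ))

theorem sum_orbitLen_le_fixCount (hσ : Confined σ) (T : Finset (PrimeOrbit σ)) {k : ℕ}
    (hk : 1 ≤ k) :
    (∑ P ∈ T, if orbitLen P ∣ k then orbitLen P else 0) ≤ fixCount σ k := by
  rw [← card_orbitUnion, ← Set.ncard_coe_finset]
  refine Set.ncard_le_ncard (t := {x | σ^[k] x = x}) (fun x hx => ?_) (hσ k hk)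
  obtain ⟨_, _, _, h⟩ := mem_orbitUnion.1 (Finset.mem_coe.1 hx)
  exact h

theorem fixCount_eq_sum_orbitLen [Fintype (PrimeOrbit σ)] {k : ℕ} (hk : 1 ≤ k) :
    fixCount σ k = ∑ P : PrimeOrbit σ, if orbitLen P ∣ k then orbitLen P else 0 := by
  rw [← card_orbitUnion, ← Set.ncard_coe_finset]
  change Set.ncard {x | σ^[k] x = x} = _
  congr 1
  ext x
  simp only [Set.mem_ofPred_eq, Finset.mem_coe, mem_orbitUnion, Finset.mem_univ, true_and]
  refine ⟨fun hx => ?_, fun ⟨_, _, hx⟩ => hx⟩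
  obtain ⟨P, hP⟩ := exists_primeOrbit_mem hk hx
  exact ⟨P, hP, hx⟩

theorem sum_fixCount_eq [Fintype (PrimeOrbit σ)] (X : ℕ) :
    ∑ k ∈ Finset.Icc 1 X, fixCount σ k =
      ∑ P : PrimeOrbit σ, orbitLen P * (X / orbitLen P) := by
  rw [Finset.sum_congr rfl fun k hk =>
    fixCount_eq_sum_orbitLen (σ := σ) (Finset.mem_Icc.1 hk).1, Finset.sum_comm]
  refine Finset.sum_congr rfl fun P _ => ?_
  rw [← Finset.sum_filter, Finset.sum_const, smul_eq_mul, mul_comm,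
    ← Nat.Ioc_filter_dvd_card_eq_div]
  rfl

theorem cesaroLim_fixCount [Fintype (PrimeOrbit σ)] :
    CesaroLim (fun k => (fixCount σ k : ℝ)) (Fintype.card (PrimeOrbit σ)) := by
  have hterm (P : PrimeOrbit σ) : Tendsto
      (fun X : ℕ => (orbitLen P : ℝ) * ((X / orbitLen P : ℕ) : ℝ) / (X : ℝ)) atTop (𝓝 1) := by
    have hpos : (0 : ℝ) < orbitLen P := by exact_mod_cast orbitLen_pos P
    have h := (tendsto_nat_floor_mul_div_atTop (R := ℝ)
      (inv_nonneg.2 hpos.le)).comp (tendsto_natCast_atTop_atTop (R := ℝ))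
    have h' := h.const_mul (orbitLen P : ℝ)
    rw [mul_inv_cancel₀ hpos.ne'] at h'
    refine h'.congr fun X => ?_
    simp only [Function.comp_apply]
    rw [inv_mul_eq_div, Nat.floor_div_eq_div, mul_div_assoc]
  have h := tendsto_finsetSum (Finset.univ : Finset (PrimeOrbit σ)) fun P _ => hterm P
  simp only [Finset.sum_const, Finset.card_univ, nsmul_eq_mul, mul_one] at h
  refine h.congr fun X => ?_
  rw [← Finset.sum_div]
  congr 1
  dsimp only
  exact_mod_cast (sum_fixCount_eq (σ := σ) X).symm

theorem sum_Pcount_eq_card [Fintype (PrimeOrbit σ)] {S : Finset ℕ}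
    (hS : ∀ P : PrimeOrbit σ, orbitLen P ∈ S) :
    ∑ ℓ ∈ S, Pcount σ ℓ = Fintype.card (PrimeOrbit σ) := by
  rw [← Finset.card_univ, Finset.card_eq_sum_card_fiberwise (fun P _ => hS P)]
  refine Finset.sum_congr rfl fun ℓ _ => ?_
  rw [Pcount, Nat.card_eq_fintype_card, Fintype.card_subtype]

end Orbits

section Growth

variable {𝒳 : Type*} {σ : 𝒳 → 𝒳}

theorem eventually_fixCount_le_exp (h : limsup (growthSeq σ) atTop ≤ 0) {ε : ℝ} (hε : 0 < ε) :
    ∀ᶠ k : ℕ in atTop, (fixCount σ k : ℝ) ≤ Real.exp (ε * k) := by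
  have hlt : limsup (growthSeq σ) atTop < (ε : EReal) :=
    h.trans_lt (by exact_mod_cast hε)
  filter_upwards [eventually_lt_of_limsup_lt hlt, eventually_gt_atTop 0] with k hk hk0
  rcases (fixCount σ k).eq_zero_or_pos with h0 | h0
  · rw [h0, Nat.cast_zero]
    exact (Real.exp_pos _).le
  have h0' : (0 : ℝ) < fixCount σ k := by exact_mod_cast h0
  have hk0' : (0 : ℝ) < k := by exact_mod_cast hk0
  rw [growthSeq, elog, if_neg h0'.not_ge, ← EReal.coe_mul, EReal.coe_lt_coe_iff,
    ← div_eq_mul_inv, div_lt_iff₀ hk0'] at hk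
  exact (Real.log_le_iff_le_exp h0').1 hk.le

theorem summable_log_zeta (h : limsup (growthSeq σ) atTop ≤ 0) {z : ℝ} (hz0 : 0 < z)
    (hz1 : z < 1) :
    Summable fun k : ℕ => (fixCount σ (k + 1) : ℝ) * z ^ (k + 1) / ((k : ℝ) + 1) := by
  obtain ⟨ε, hε, hεz⟩ : ∃ ε : ℝ, 0 < ε ∧ Real.exp ε * z < 1 := by
    refine ⟨-Real.log z / 2, by linarith [Real.log_neg hz0 hz1], ?_⟩
    rw [← Real.exp_log hz0, ← Real.exp_add, Real.log_exp, Real.exp_lt_one_iff]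
    linarith [Real.log_neg hz0 hz1]
  refine Summable.of_norm_bounded_eventually_nat (g := fun k => (Real.exp ε * z) ^ (k + 1))
    ((summable_nat_add_iff 1).2 (summable_geometric_of_lt_one (by positivity) hεz)) ?_
  filter_upwards [(tendsto_add_atTop_nat 1).eventually (eventually_fixCount_le_exp h hε)] with k hk
  rw [Real.norm_of_nonneg (by positivity)]
  calc (fixCount σ (k + 1) : ℝ) * z ^ (k + 1) / ((k : ℝ) + 1)
      ≤ (fixCount σ (k + 1) : ℝ) * z ^ (k + 1) :=
        div_le_self (by positivity) (by linarith [k.cast_nonneg (α := ℝ)])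
    _ ≤ Real.exp (ε * (k + 1 : ℕ)) * z ^ (k + 1) := by gcongr
    _ = (Real.exp ε * z) ^ (k + 1) := by
      rw [mul_comm ε, Real.exp_nat_mul, mul_pow]

theorem hasSum_dvd_pow_div {ℓ : ℕ} (hℓ : 0 < ℓ) {z : ℝ} (hz0 : 0 ≤ z) (hz1 : z < 1) :
    HasSum (fun k : ℕ => ((if ℓ ∣ k + 1 then ℓ else 0 : ℕ) : ℝ) * z ^ (k + 1) / ((k : ℝ) + 1))
      (-Real.log (1 - z ^ ℓ)) := by
  have hinj : Function.Injective fun j : ℕ => ℓ * (j + 1) - 1 := by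
    intro i j hij
    have hi : 0 < ℓ * (i + 1) := by positivity
    have hj : 0 < ℓ * (j + 1) := by positivity
    have : ℓ * (i + 1) = ℓ * (j + 1) := by
      simp only at hij
      omega
    simpa using Nat.eq_of_mul_eq_mul_left hℓ this
  rw [← hinj.hasSum_iff]
  · have habs : |z ^ ℓ| < 1 := by
      rw [abs_of_nonneg (by positivity)]
      exact pow_lt_one₀ hz0 hz1 hℓ.ne'
    convert Real.hasSum_pow_div_log_of_abs_lt_one habs using 2 with j
    have hsub : ℓ * (j + 1) - 1 + 1 = ℓ * (j + 1) := Nat.sub_add_cancel (Nat.mul_pos hℓ j.succ_pos)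
    have hcast : ((ℓ * (j + 1) - 1 : ℕ) : ℝ) + 1 = ℓ * (j + 1) := by exact_mod_cast hsub
    have hℓ' : (ℓ : ℝ) ≠ 0 := by exact_mod_cast hℓ.ne'
    simp only [Function.comp_apply]
    rw [hsub, if_pos (dvd_mul_right _ _), hcast, pow_mul, mul_div_mul_left _ _ hℓ']
  · intro k hk
    rw [if_neg]
    · simp
    rintro ⟨m, hm⟩
    refine hk ⟨m - 1, ?_⟩
    have hm0 : m ≠ 0 := by
      rintro rfl
      simp at hm
    simp only [Nat.sub_add_cancel (Nat.one_le_iff_ne_zero.2 hm0), ← hm, Nat.add_sub_cancel]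

theorem one_le_exp_log_zeta_mul (hσ : Confined σ) (h : limsup (growthSeq σ) atTop ≤ 0)
    (T : Finset (PrimeOrbit σ)) {z : ℝ} (hz0 : 0 < z) (hz1 : z < 1) :
    1 ≤ Real.exp (∑' k : ℕ, (fixCount σ (k + 1) : ℝ) * z ^ (k + 1) / ((k : ℝ) + 1)) *
      ((∏ P ∈ T, (orbitLen P : ℝ)) * (1 - z) ^ T.card) := by
  have hsum := hasSum_sum fun (P : PrimeOrbit σ) (_ : P ∈ T) =>
    hasSum_dvd_pow_div (orbitLen_pos P) hz0.le hz1
  have hle := hasSum_le (fun k => ?_) hsum (summable_log_zeta h hz0 hz1).hasSum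
  · have hpos (P : PrimeOrbit σ) : 0 < 1 - z ^ orbitLen P :=
      sub_pos.2 (pow_lt_one₀ hz0.le hz1 (orbitLen_pos P).ne')
    calc (1 : ℝ) = Real.exp (∑ P ∈ T, -Real.log (1 - z ^ orbitLen P)) *
          ∏ P ∈ T, (1 - z ^ orbitLen P) := by
          rw [Real.exp_sum, ← Finset.prod_mul_distrib]
          refine (Finset.prod_eq_one fun P _ => ?_).symm
          rw [Real.exp_neg, Real.exp_log (hpos P), inv_mul_cancel₀ (hpos P).ne']
      _ ≤ _ := by
          rw [← Finset.prod_const, ← Finset.prod_mul_distrib]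
          refine mul_le_mul (Real.exp_le_exp.2 hle) (Finset.prod_le_prod (fun P _ => (hpos P).le)
            fun P _ => ?_) (Finset.prod_nonneg fun P _ => (hpos P).le) (Real.exp_pos _).le
          have := one_add_mul_le_pow (a := z - 1) (by linarith) (orbitLen P)
          rw [add_sub_cancel] at this
          linarith
  · rw [← Finset.sum_div, ← Finset.sum_mul]
    gcongr
    exact_mod_cast sum_orbitLen_le_fixCount hσ T k.succ_pos

theorem fixCount_eq_zero_of_isEmpty [IsEmpty (PrimeOrbit σ)] {k : ℕ} (hk : 1 ≤ k) :
    fixCount σ k = 0 := by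
  have := Fintype.ofIsEmpty (α := PrimeOrbit σ)
  rw [fixCount_eq_sum_orbitLen hk, Finset.univ_eq_empty, Finset.sum_empty]

theorem nonempty_primeOrbit (h : limsup (growthSeq σ) atTop = 0) : Nonempty (PrimeOrbit σ) := by
  by_contra hne
  rw [not_nonempty_iff] at hne
  have hbot : growthSeq σ =ᶠ[atTop] fun _ => ⊥ := by
    filter_upwards [eventually_gt_atTop 0] with k hk
    have hk' : (0 : ℝ) < (k : ℝ)⁻¹ := by positivity
    rw [growthSeq, fixCount_eq_zero_of_isEmpty hk, elog, if_pos (by simp),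
      EReal.bot_mul_coe_of_pos hk']
  rw [limsup_congr hbot, limsup_const] at h
  exact EReal.bot_ne_zero h

end Growth

/-- A rational function is at most of order `(1 - z)⁻ᵐ` as `z → 1⁻`, where `m` is the order of
vanishing of its denominator at `1`. -/
theorem le_rootMultiplicity_one {p q : Polynomial ℝ} (hq : q ≠ 0) {E : ℝ → ℝ} {C : ℝ} {n : ℕ}
    (hE : ∀ z : ℝ, 0 < z → z < 1 → E z * q.eval z = p.eval z)
    (hn : ∀ z : ℝ, 0 < z → z < 1 → 1 ≤ E z * (C * (1 - z) ^ n)) :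
    n ≤ q.rootMultiplicity 1 := by
  obtain ⟨r, hqr, hr⟩ := q.exists_eq_pow_rootMultiplicity_mul_and_not_dvd hq 1
  set m := q.rootMultiplicity 1
  by_contra! hmn
  have hbound : ∀ᶠ z in 𝓝[<] (1 : ℝ),
      |r.eval z| ≤ |p.eval z| * (|C| * (1 - z) ^ (n - m)) := by
    filter_upwards [Ioo_mem_nhdsLT (zero_lt_one' ℝ)] with z ⟨hz0, hz1⟩
    have hz : 0 < 1 - z := by linarith
    have hqz : |q.eval z| = (1 - z) ^ m * |r.eval z| := by
      conv_lhs => rw [hqr]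
      simp only [Polynomial.eval_mul, Polynomial.eval_pow, Polynomial.eval_sub,
        Polynomial.eval_X, Polynomial.eval_C, abs_mul, abs_pow]
      rw [abs_sub_comm, abs_of_pos hz]
    have h1 : 1 ≤ |E z| * (|C| * (1 - z) ^ n) := by
      have := (hn z hz0 hz1).trans (le_abs_self _)
      rwa [abs_mul, abs_mul, abs_of_pos (pow_pos hz n)] at this
    refine le_of_mul_le_mul_left ?_ (pow_pos hz m)
    calc (1 - z) ^ m * |r.eval z| = 1 * |q.eval z| := by rw [hqz, one_mul]
      _ ≤ |E z| * (|C| * (1 - z) ^ n) * |q.eval z| := by gcongr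
      _ = |p.eval z| * (|C| * (1 - z) ^ n) := by
        rw [← hE z hz0 hz1, abs_mul]
        ring
      _ = (1 - z) ^ m * (|p.eval z| * (|C| * (1 - z) ^ (n - m))) := by
        rw [← Nat.add_sub_cancel' hmn.le, pow_add, Nat.add_sub_cancel_left]
        ring
  have hlim : Tendsto (fun z : ℝ => |p.eval z| * (|C| * (1 - z) ^ (n - m))) (𝓝[<] 1) (𝓝 0) := by
    have hcont : Continuous fun z : ℝ => |p.eval z| * (|C| * (1 - z) ^ (n - m)) := by fun_prop
    have := (hcont.tendsto 1).mono_left (nhdsWithin_le_nhds (s := Set.Iio 1))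
    simpa [zero_pow (Nat.sub_pos_of_lt hmn).ne'] using this
  have hr' : Tendsto (fun z : ℝ => |r.eval z|) (𝓝[<] 1) (𝓝 |r.eval 1|) :=
    (r.continuous.abs.tendsto 1).mono_left nhdsWithin_le_nhds
  have hr1 : r.eval 1 = 0 := abs_nonpos_iff.1 (le_of_tendsto_of_tendsto hr' hlim hbound)
  exact hr (Polynomial.dvd_iff_isRoot.2 hr1)

theorem finite_primeOrbit {𝒳 : Type*} {σ : 𝒳 → 𝒳} (hσ : Confined σ)
    (hΛ : limsup (growthSeq σ) atTop ≤ 0)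
    (hrat : ∃ p q : Polynomial ℝ, q ≠ 0 ∧ ∀ z : ℝ, 0 ≤ z → z < 1 →
      Real.exp (∑' k : ℕ, (fixCount σ (k + 1) : ℝ) * z ^ (k + 1) / ((k : ℝ) + 1)) *
          q.eval z = p.eval z) :
    Finite (PrimeOrbit σ) := by
  obtain ⟨p, q, hq, hpq⟩ := hrat
  by_contra hinf
  rw [not_finite_iff_infinite] at hinf
  obtain ⟨T, hT⟩ := Infinite.exists_subset_card_eq (PrimeOrbit σ) (q.rootMultiplicity 1 + 1)
  have := le_rootMultiplicity_one hq (fun z hz0 hz1 => hpq z hz0.le hz1)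
    fun z hz0 hz1 => one_le_exp_log_zeta_mul hσ hΛ T hz0 hz1
  omega

/-- Proposition: a confined self-map with growth rate `Λ = 1` and rational dynamical
zeta function `ζ_σ(z) = exp(Σ_{k≥1} σ_k z^k / k)` has periodic fixed-point counts, say of
period `ϖ`; the average `B` of `σ_k` over a period is a positive integer, equals the
Cesàro mean `𝒞(σ_k)`, `P_ℓ = 0` unless `ℓ ∣ ϖ`, the set of prime orbits is finite of
cardinality `B` (so `Σ_{ℓ ∣ ϖ} P_ℓ = B`), and `M_σ(X) = B` for all `X > ϖ`. -/
theorem growth_one_rational_zeta {𝒳 : Type*} (σ : 𝒳 → 𝒳) (hσ : Confined σ)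
    (hΛ : Filter.limsup (growthSeq σ) atTop = (0 : EReal))
    (hrat : ∃ p q : Polynomial ℝ, q ≠ 0 ∧ ∀ z : ℝ, 0 ≤ z → z < 1 →
      Real.exp (∑' k : ℕ, (fixCount σ (k + 1) : ℝ) * z ^ (k + 1) / ((k : ℝ) + 1)) *
          q.eval z = p.eval z) :
    ∃ ϖ b : ℕ, 0 < ϖ ∧ 0 < b ∧
      (∀ k, 1 ≤ k → fixCount σ (k + ϖ) = fixCount σ k) ∧
      (b : ℝ) = (∑ k ∈ Finset.Icc 1 ϖ, (fixCount σ k : ℝ)) / (ϖ : ℝ) ∧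
      CesaroLim (fun k => (fixCount σ k : ℝ)) (b : ℝ) ∧
      (∀ ℓ : ℕ, 1 ≤ ℓ → ¬ ℓ ∣ ϖ → Pcount σ ℓ = 0) ∧
      Finite (PrimeOrbit σ) ∧ Nat.card (PrimeOrbit σ) = b ∧
      (∑ ℓ ∈ ϖ.divisors, Pcount σ ℓ) = b ∧
      (∀ X : ℕ, ϖ < X → Mfun σ 1 X = (b : ℝ)) := by
  have := finite_primeOrbit hσ hΛ.le hrat
  have := Fintype.ofFinite (PrimeOrbit σ)
  have := nonempty_primeOrbit hΛ
  set ϖ := (Finset.univ : Finset (PrimeOrbit σ)).lcm orbitLen with hϖ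
  have hdvd (P : PrimeOrbit σ) : orbitLen P ∣ ϖ := Finset.dvd_lcm (Finset.mem_univ P)
  have hϖ0 : 0 < ϖ := by
    rw [Nat.pos_iff_ne_zero, hϖ, Ne, Finset.lcm_eq_zero_iff]
    rintro ⟨P, -, hP⟩
    exact (orbitLen_pos P).ne' hP
  refine ⟨ϖ, Fintype.card (PrimeOrbit σ), hϖ0, Fintype.card_pos, fun k hk => ?_, ?_,
    cesaroLim_fixCount, fun ℓ _ hℓ => ?_, inferInstance, Nat.card_eq_fintype_card,
    sum_Pcount_eq_card fun P => Nat.mem_divisors.2 ⟨hdvd P, hϖ0.ne'⟩, fun X hX => ?_⟩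
  · rw [fixCount_eq_sum_orbitLen (le_add_right hk), fixCount_eq_sum_orbitLen hk]
    simp only [Nat.dvd_add_left (hdvd _)]
  · rw [eq_div_iff (by exact_mod_cast hϖ0.ne'), ← Nat.cast_sum, sum_fixCount_eq,
      Finset.sum_congr rfl fun P _ => Nat.mul_div_cancel' (hdvd P)]
    simp
  · have : IsEmpty {P : PrimeOrbit σ // orbitLen P = ℓ} := ⟨fun P => hℓ (P.2 ▸ hdvd P.1)⟩
    exact Nat.card_of_isEmpty
  · simp only [Mfun, one_pow, div_one]
    rw [← Nat.cast_sum, sum_Pcount_eq_card fun P => Finset.mem_Icc.2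
      ⟨orbitLen_pos P, (Nat.le_of_dvd hϖ0 (hdvd P)).trans hX.le⟩]
end
end

section
/- Let 𝒳 be a set and σ : 𝒳 → 𝒳 a confined self-map such that (𝒳, σ) is a FAD-system, i.e. σ_k = c^k · |det(A^k − I)| · r_k · ∏_{p ∈ S} |k|_p^{s_{p,k}} · p^{−t_{p,k}·|k|_p^{−1}} for all k ≥ 1, where c ∈ ℝ_{>0}, A is a square integer matrix with det(A^k − I) ≠ 0 for all k (this determinant factor may also be entirely absent), r_k ∈ ℝ_{>0} is a periodic gcd-sequence, S is a finite set of primes, and for each p ∈ S the sequences s_{p,k}, t_{p,k} ∈ ℝ_{≥0} are periodic gcd-sequences with period coprime to p. If the growth rate Λ satisfies Λ > 1, then Λ is finite and the Cesàro mean B := 𝒞(σ_k/Λ^k) exists and is strictly positive. -/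
open Filter Topology Real MeasureTheory Asymptotics
open scoped Classical

noncomputable section

/-- Bohr almost periodicity of a real sequence, in terms of finite colourings: for every `ε > 0`
the indices can be coloured by finitely many colours so that the difference of two indices of the
same colour is an `ε`-almost period. -/
def BohrAP (a : ℕ → ℝ) : Prop :=
  ∀ ε : ℝ, 0 < ε → ∃ (ι : Type) (_ : Finite ι) (col : ℕ → ι),
    ∀ m n, col m = col (m + n) → ∀ k, |a (k + n) - a k| ≤ ε

namespace BohrAP

theorem of_dvd {a : ℕ → ℝ}
    (ha : ∀ ε : ℝ, 0 < ε → ∃ q : ℕ, 0 < q ∧ ∀ n, q ∣ n → ∀ k, |a (k + n) - a k| ≤ ε) :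
    BohrAP a := by
  intro ε hε
  obtain ⟨q, hq, h⟩ := ha ε hε
  refine ⟨Fin q, inferInstance, fun m => ⟨m % q, Nat.mod_lt _ hq⟩, fun m n hmn => h n ?_⟩
  have h1 : m ≡ m + n [MOD q] := by simpa [Nat.ModEq] using hmn
  exact (Nat.modEq_zero_iff_dvd).1 (Nat.ModEq.add_left_cancel' m (by simpa using h1)).symm

theorem of_periodic {a : ℕ → ℝ} {q : ℕ} (hq : 0 < q) (ha : ∀ k, a (k + q) = a k) :
    BohrAP a := by
  refine of_dvd fun ε hε => ⟨q, hq, ?_⟩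
  rintro _ ⟨j, rfl⟩ k
  have hper : Function.Periodic a q := ha
  have : a (k + q * j) = a k := by rw [mul_comm]; exact hper.nat_mul j k
  rw [this]; simpa using hε.le

/-- A function of `k mod q` and of the `p`-adic valuation of `k + 1` is almost periodic as soon as
it converges when the valuation grows. -/
theorem of_padicValNat {p : ℕ} (hp : p.Prime) {F : ℕ → ℕ → ℝ} {q : ℕ} (hq : 0 < q)
    (hper : ∀ k v, F (k + q) v = F k v) (hF : ∀ k, CauchySeq (F k)) :
    BohrAP fun k => F k (padicValNat p (k + 1)) := by
  have := Fact.mk hp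
  refine of_dvd fun ε hε => ?_
  have hV : ∀ i, ∃ V, ∀ v ≥ V, ∀ w ≥ V, dist (F i v) (F i w) < ε := fun i =>
    Metric.cauchySeq_iff.1 (hF i) ε hε
  choose V hV using hV
  set W := (Finset.range q).sup V
  have hmod : ∀ k, F (k % q) = F k := fun k => by
    have h : Function.Periodic F q := fun k => funext (hper k)
    exact h.map_mod_nat k
  refine ⟨q * p ^ W, Nat.mul_pos hq (pow_pos hp.pos _), fun n hn k => ?_⟩
  have hFn : F (k + n) = F k := by
    obtain ⟨j, rfl⟩ := (Dvd.intro _ rfl : q ∣ q * p ^ W).trans hn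
    rw [← hmod, Nat.add_mul_mod_self_left, hmod]
  have hdvd : ∀ j ≤ W, (j ≤ padicValNat p (k + n + 1) ↔ j ≤ padicValNat p (k + 1)) := by
    intro j hj
    rw [← padicValNat_dvd_iff_le (by omega), ← padicValNat_dvd_iff_le (by omega)]
    have : p ^ j ∣ n := (pow_dvd_pow p hj).trans ((Dvd.intro_left _ rfl).trans hn)
    rw [show k + n + 1 = k + 1 + n by ring]
    exact Nat.dvd_add_left this
  simp only [hFn]
  rcases lt_or_ge (padicValNat p (k + 1)) W with h | h
  · have h1 := (hdvd _ h.le).2 le_rfl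
    have h2 := hdvd _ (Nat.succ_le_of_lt h)
    have : padicValNat p (k + n + 1) = padicValNat p (k + 1) := by omega
    rw [this]; simpa using hε.le
  · have h1 := (hdvd W le_rfl).2 h
    have hVW : V (k % q) ≤ W := Finset.le_sup (Finset.mem_range.2 (Nat.mod_lt _ hq))
    rw [← hmod k]
    exact (hV (k % q) _ (hVW.trans h1) _ (hVW.trans h)).le

/-- Finitely many return times suffice: every window of a fixed length contains an
`ε`-almost period. -/
theorem exists_almost_period {a : ℕ → ℝ} (ha : BohrAP a) {ε : ℝ} (hε : 0 < ε) :
    ∃ K : ℕ, ∀ m, ∃ n, m ≤ n ∧ n ≤ m + K ∧ ∀ k, |a (k + n) - a k| ≤ ε := by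
  obtain ⟨ι, hι, col, hcol⟩ := ha ε hε
  have hfin : (Set.range col).Finite := Set.toFinite _
  have hrep : ∃ K : ℕ, ∀ i ∈ Set.range col, ∃ j ≤ K, col j = i := by
    choose! g hg using fun (i : ι) (hi : i ∈ Set.range col) => hi
    obtain ⟨K, hK⟩ := (hfin.image g).bddAbove
    exact ⟨K, fun i hi => ⟨g i, hK ⟨i, hi, rfl⟩, hg i hi⟩⟩
  obtain ⟨K, hK⟩ := hrep
  refine ⟨K, fun m => ?_⟩
  obtain ⟨j, hj, hjc⟩ := hK (col (m + K)) ⟨_, rfl⟩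
  refine ⟨m + K - j, by omega, by omega, hcol j _ ?_⟩
  rw [hjc]; congr 1; omega

theorem bounded {a : ℕ → ℝ} (ha : BohrAP a) : ∃ B : ℝ, 0 < B ∧ ∀ k, |a k| ≤ B := by
  obtain ⟨K, hK⟩ := ha.exists_almost_period one_pos
  refine ⟨(∑ i ∈ Finset.range (K + 1), |a i|) + 1, by positivity, fun k => ?_⟩
  have hle : ∀ j ≤ K, |a j| ≤ ∑ i ∈ Finset.range (K + 1), |a i| := fun j hj =>
    Finset.single_le_sum (f := fun i => |a i|) (fun i _ => abs_nonneg _)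
      (Finset.mem_range.2 (by omega))
  rcases le_or_gt k K with h | h
  · linarith [hle k h]
  · obtain ⟨n, hn1, hn2, hn⟩ := hK (k - K)
    have h1 := hn (k - n)
    rw [Nat.sub_add_cancel (by omega)] at h1
    have h2 := hle (k - n) (by omega)
    have h3 := abs_sub_abs_le_abs_sub (a k) (a (k - n))
    linarith

theorem mul {a b : ℕ → ℝ} (ha : BohrAP a) (hb : BohrAP b) : BohrAP fun k => a k * b k := by
  obtain ⟨A, hA0, hA⟩ := ha.bounded
  obtain ⟨B, hB0, hB⟩ := hb.bounded
  intro ε hε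
  obtain ⟨ι, hι, c, hc⟩ := ha (ε / (2 * B)) (by positivity)
  obtain ⟨κ, hκ, c', hc'⟩ := hb (ε / (2 * A)) (by positivity)
  refine ⟨ι × κ, inferInstance, fun k => (c k, c' k), fun m n h k => ?_⟩
  have h1 := hc m n (Prod.ext_iff.1 h).1 k
  have h2 := hc' m n (Prod.ext_iff.1 h).2 k
  have e : a (k + n) * b (k + n) - a k * b k
      = a (k + n) * (b (k + n) - b k) + (a (k + n) - a k) * b k := by ring
  calc |a (k + n) * b (k + n) - a k * b k|
      ≤ |a (k + n)| * |b (k + n) - b k| + |a (k + n) - a k| * |b k| := by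
        rw [e, ← abs_mul, ← abs_mul]; exact abs_add_le _ _
    _ ≤ A * (ε / (2 * A)) + ε / (2 * B) * B := by
        gcongr
        · exact hA _
        · exact hB _
    _ = ε := by field_simp; ring

theorem prod {ι : Type*} {a : ι → ℕ → ℝ} (s : Finset ι) (ha : ∀ i ∈ s, BohrAP (a i)) :
    BohrAP fun k => ∏ i ∈ s, a i k := by
  induction s using Finset.induction_on with
  | empty => simpa using of_periodic (a := fun _ => 1) one_pos fun _ => rfl
  | insert i s hi ih =>
    simp only [Finset.prod_insert hi]
    exact (ha i (Finset.mem_insert_self _ _)).mul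
      (ih fun j hj => ha j (Finset.mem_insert_of_mem hj))

theorem norm_pow_sub_one {z : ℂ} (hz : ‖z‖ = 1) : BohrAP fun k => ‖z ^ (k + 1) - 1‖ := by
  intro ε hε
  obtain ⟨t, -, htf, ht⟩ := finite_cover_balls_of_compact
    (isCompact_sphere (0 : ℂ) 1) (half_pos hε)
  have hmem : ∀ k : ℕ, ∃ x : t, dist (z ^ k) x < ε / 2 := fun k => by
    have : z ^ k ∈ Metric.sphere (0 : ℂ) 1 := by simp [hz]
    simpa using ht this
  choose col hcol using hmem
  refine ⟨ULift (Fin htf.toFinset.card), inferInstance,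
    fun k => ⟨htf.toFinset.equivFin ⟨col k, by simp⟩⟩, fun m n h k => ?_⟩
  have h0 : col m = col (m + n) := by
    have := htf.toFinset.equivFin.injective (ULift.up_injective h)
    exact Subtype.ext (by simpa using this)
  have h1 := hcol m
  have h2 := hcol (m + n)
  rw [← h0] at h2
  have h3 : dist (z ^ (m + n)) (z ^ m) < ε := by
    have := dist_triangle_right (z ^ (m + n)) (z ^ m) (col m)
    linarith
  have e : z ^ (m + n) - z ^ m = z ^ m * (z ^ n - 1) := by ring
  rw [dist_eq_norm, e, norm_mul, norm_pow, hz, one_pow, one_mul] at h3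
  have e' : (z ^ (k + n + 1) - 1) - (z ^ (k + 1) - 1) = z ^ (k + 1) * (z ^ n - 1) := by ring
  calc |‖z ^ (k + n + 1) - 1‖ - ‖z ^ (k + 1) - 1‖|
      ≤ ‖(z ^ (k + n + 1) - 1) - (z ^ (k + 1) - 1)‖ := abs_norm_sub_norm_le _ _
    _ = ‖z ^ n - 1‖ := by rw [e', norm_mul, norm_pow, hz, one_pow, one_mul]
    _ ≤ ε := h3.le

/-- Values of an almost periodic sequence recur with positive frequency. -/
theorem exists_recurrence {a : ℕ → ℝ} (ha : BohrAP a) {δ : ℝ} (hδ : δ < a 0) :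
    ∃ K : ℕ, ∀ m, ∃ n, m ≤ n ∧ n ≤ m + K ∧ δ ≤ a n := by
  obtain ⟨K, hK⟩ := ha.exists_almost_period (sub_pos.2 hδ)
  refine ⟨K, fun m => ?_⟩
  obtain ⟨n, h1, h2, h3⟩ := hK m
  have := abs_le.1 (h3 0)
  rw [zero_add] at this
  exact ⟨n, h1, h2, by linarith [this.1]⟩

theorem sum_approx {a : ℕ → ℝ} (ha : BohrAP a) {ε : ℝ} (hε : 0 < ε) :
    ∃ C : ℝ, 0 ≤ C ∧ ∀ m X : ℕ,
      |∑ k ∈ Finset.range X, a (m + k) - ∑ k ∈ Finset.range X, a k| ≤ ε * X + C := by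
  obtain ⟨B, hB0, hB⟩ := ha.bounded
  obtain ⟨K, hK⟩ := ha.exists_almost_period hε
  have hs : ∀ m j : ℕ, |∑ k ∈ Finset.range j, a (m + k)| ≤ B * j := fun m j => by
    refine (Finset.abs_sum_le_sum_abs _ _).trans ?_
    refine (Finset.sum_le_card_nsmul _ _ B fun i _ => hB _).trans_eq ?_
    simp [mul_comm]
  refine ⟨B * K + B * K, by positivity, fun m X => ?_⟩
  obtain ⟨n, hn1, hn2, hn⟩ := hK m
  obtain ⟨j, rfl⟩ := Nat.exists_eq_add_of_le hn1
  have hj : (j : ℝ) ≤ K := by exact_mod_cast (by omega : j ≤ K)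
  have h1 : |∑ k ∈ Finset.range X, a (m + j + k) - ∑ k ∈ Finset.range X, a k| ≤ ε * X := by
    rw [← Finset.sum_sub_distrib]
    refine (Finset.abs_sum_le_sum_abs _ _).trans ?_
    refine (Finset.sum_le_card_nsmul _ _ ε fun i _ => ?_).trans_eq ?_
    · rw [add_comm]; exact hn i
    · simp [mul_comm]
  have e1 : ∑ k ∈ Finset.range (j + X), a (m + k) = ∑ k ∈ Finset.range j, a (m + k)
      + ∑ k ∈ Finset.range X, a (m + j + k) := by
    rw [Finset.sum_range_add]; simp [add_assoc]
  have e2 : ∑ k ∈ Finset.range (X + j), a (m + k) = ∑ k ∈ Finset.range X, a (m + k)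
      + ∑ k ∈ Finset.range j, a (m + X + k) := by
    rw [Finset.sum_range_add]; simp [add_assoc]
  rw [add_comm X j] at e2
  have h2 := abs_le.1 (hs m j)
  have h3 := abs_le.1 (hs (m + X) j)
  have h4 : B * j ≤ B * K := by gcongr
  have h5 := abs_le.1 h1
  rw [abs_le]
  constructor <;> linarith [h2.1, h2.2, h3.1, h3.2, h5.1, h5.2]

/-- Bohr almost periodic sequences have a mean. -/
theorem exists_mean {a : ℕ → ℝ} (ha : BohrAP a) :
    ∃ M : ℝ, Tendsto (fun X : ℕ => (∑ k ∈ Finset.range X, a k) / (X : ℝ)) atTop (𝓝 M) := by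
  obtain ⟨B, hB0, hB⟩ := ha.bounded
  set s : ℕ → ℝ := fun X => ∑ k ∈ Finset.range X, a k with hs_def
  have hs : ∀ m j : ℕ, |∑ k ∈ Finset.range j, a (m + k)| ≤ B * j := fun m j => by
    refine (Finset.abs_sum_le_sum_abs _ _).trans ?_
    refine (Finset.sum_le_card_nsmul _ _ B fun i _ => hB _).trans_eq ?_
    simp [mul_comm]
  apply cauchySeq_tendsto_of_complete
  rw [Metric.cauchySeq_iff']
  suffices h : ∀ ε > 0, ∃ c : ℝ, ∃ N, ∀ Y ≥ N, |s Y / Y - c| < ε by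
    intro ε hε
    obtain ⟨c, N, hN⟩ := h (ε / 2) (half_pos hε)
    refine ⟨N, fun Y hY => ?_⟩
    have h1 := abs_lt.1 (hN Y hY)
    have h2 := abs_lt.1 (hN N le_rfl)
    rw [Real.dist_eq, abs_lt]
    constructor <;> linarith [h1.1, h1.2, h2.1, h2.2]
  intro ε hε
  obtain ⟨C, hC0, hC⟩ := ha.sum_approx (show 0 < ε / 4 by linarith)
  obtain ⟨X, hX⟩ := exists_nat_gt (C / (ε / 4))
  have hX0 : (0 : ℝ) < X := lt_of_le_of_lt (by positivity) hX
  have hCX : C < ε / 4 * X := by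
    rw [div_lt_iff₀ (by positivity)] at hX; linarith
  obtain ⟨N, hN⟩ := exists_nat_gt (2 * X * B / (ε / 4))
  refine ⟨s X / X, N + 1, fun Y hY => ?_⟩
  have hNY : (N : ℝ) < Y := by exact_mod_cast (by omega : N < Y)
  have hY0 : (0 : ℝ) < Y := lt_of_le_of_lt (Nat.cast_nonneg _) hNY
  have hBY : 2 * X * B < ε / 4 * Y := by
    rw [div_lt_iff₀ (by positivity)] at hN
    nlinarith
  have hq : ∀ q : ℕ, |s (q * X) - q * s X| ≤ q * (ε / 4 * X + C) := by
    intro q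
    induction q with
    | zero => simp [hs_def]
    | succ q ih =>
      have e : s ((q + 1) * X) = s (q * X) + ∑ k ∈ Finset.range X, a (q * X + k) := by
        simp only [hs_def, add_mul, one_mul]; rw [Finset.sum_range_add]
      have h1 := abs_le.1 (hC (q * X) X)
      have h2 := abs_le.1 ih
      push_cast
      rw [e, abs_le]
      simp only [hs_def] at *
      constructor <;> linarith [h1.1, h1.2, h2.1, h2.2]
  set q := Y / X
  set ρ := Y % X
  have hXn : 0 < X := by exact_mod_cast hX0
  have hρ : (ρ : ℝ) ≤ X := by exact_mod_cast (Nat.mod_lt Y hXn).le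
  have hYq : q * X + ρ = Y := Nat.div_add_mod' Y X
  have hYqR : (q : ℝ) * X + ρ = Y := by exact_mod_cast hYq
  have h1 : |s Y - q * s X| ≤ q * (ε / 4 * X + C) + B * X := by
    have e : s Y = s (q * X) + ∑ k ∈ Finset.range ρ, a (q * X + k) := by
      rw [← hYq]; simp only [hs_def]; rw [Finset.sum_range_add]
    have h2 := abs_le.1 (hq q)
    have h3 := abs_le.1 (hs (q * X) ρ)
    have h4 : B * ρ ≤ B * X := by gcongr
    rw [e, abs_le]
    constructor <;> linarith [h2.1, h2.2, h3.1, h3.2]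
  have h2 : |s X| ≤ B * X := by simpa using hs 0 X
  have h3 : |s X / X * Y - q * s X| ≤ B * X := by
    have e : s X / X * Y - q * s X = s X / X * ρ := by
      rw [← hYqR]; field_simp; ring
    rw [e, abs_mul, abs_div, abs_of_pos hX0, abs_of_nonneg (Nat.cast_nonneg ρ : (0 : ℝ) ≤ ρ)]
    calc |s X| / X * ρ ≤ B * X / X * X := by gcongr
      _ = B * X := by field_simp
  have h4 : |s Y - s X / X * Y| < ε * Y := by
    have hqX : (q : ℝ) * X ≤ Y := by rw [← hYqR]; simp
    have hqC : (q : ℝ) * (ε / 4 * X + C) ≤ ε / 2 * Y := by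
      calc (q : ℝ) * (ε / 4 * X + C) ≤ q * (ε / 2 * X) := by gcongr; linarith
        _ = ε / 2 * (q * X) := by ring
        _ ≤ ε / 2 * Y := by gcongr
    have h1' := abs_le.1 h1
    have h3' := abs_le.1 h3
    have : 0 < ε * Y := by positivity
    rw [abs_lt]
    constructor <;> linarith [h1'.1, h1'.2, h3'.1, h3'.2]
  have e : s Y / Y - s X / X = (s Y - s X / X * Y) / Y := by field_simp
  rw [e, abs_div, abs_of_pos hY0, div_lt_iff₀ hY0]
  exact h4

/-- A nonnegative almost periodic sequence with positive initial value has a positive mean. -/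
theorem mean_pos {a : ℕ → ℝ} (ha : BohrAP a) (hnn : ∀ k, 0 ≤ a k) (h0 : 0 < a 0) {M : ℝ}
    (hM : Tendsto (fun X : ℕ => (∑ k ∈ Finset.range X, a k) / (X : ℝ)) atTop (𝓝 M)) :
    0 < M := by
  obtain ⟨K, hK⟩ := ha.exists_recurrence (half_lt_self h0)
  have hq : ∀ q : ℕ, q * (a 0 / 2) ≤ ∑ k ∈ Finset.range (q * (K + 1)), a k := by
    intro q
    induction q with
    | zero => simp
    | succ q ih =>
      obtain ⟨n, h1, h2, h3⟩ := hK (q * (K + 1))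
      obtain ⟨j, rfl⟩ := Nat.exists_eq_add_of_le h1
      rw [add_mul, one_mul, Finset.sum_range_add]
      have := Finset.single_le_sum (f := fun k => a (q * (K + 1) + k))
        (fun i _ => hnn _) (Finset.mem_range.2 (by omega : j < K + 1))
      push_cast
      linarith
  have hsub : Tendsto (fun q : ℕ => (q + 1) * (K + 1)) atTop atTop :=
    tendsto_atTop_mono (fun q => by simp only [id]; nlinarith [Nat.zero_le (q * K)]) tendsto_id
  have hlim := hM.comp hsub
  have hpos : 0 < a 0 / 2 / (K + 1) := by positivity
  refine lt_of_lt_of_le hpos (ge_of_tendsto' hlim fun q => ?_)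
  have := hq (q + 1)
  simp only [Function.comp]
  rw [div_le_div_iff₀ (by positivity) (by positivity)]
  push_cast at this ⊢
  nlinarith

end BohrAP

/-- The product of an everywhere positive almost periodic sequence and a sequence tending
to `1`. -/
def AsympAP (u : ℕ → ℝ) : Prop :=
  ∃ b e : ℕ → ℝ, BohrAP b ∧ (∀ k, 0 < b k) ∧ Tendsto e atTop (𝓝 1) ∧ ∀ k, u k = b k * e k

theorem BohrAP.asympAP {b : ℕ → ℝ} (hb : BohrAP b) (hpos : ∀ k, 0 < b k) : AsympAP b :=
  ⟨b, fun _ => 1, hb, hpos, tendsto_const_nhds, fun _ => (mul_one _).symm⟩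

theorem asympAP_of_tendsto_one {e : ℕ → ℝ} (he : Tendsto e atTop (𝓝 1)) : AsympAP e :=
  ⟨fun _ => 1, e, BohrAP.of_periodic one_pos fun _ => rfl, fun _ => one_pos, he,
    fun _ => (one_mul _).symm⟩

namespace AsympAP

theorem mul {u v : ℕ → ℝ} (hu : AsympAP u) (hv : AsympAP v) : AsympAP fun k => u k * v k := by
  obtain ⟨b, e, hb, hb0, he, hu⟩ := hu
  obtain ⟨b', e', hb', hb0', he', hv⟩ := hv
  refine ⟨_, fun k => e k * e' k, hb.mul hb', fun k => mul_pos (hb0 k) (hb0' k),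
    by simpa using he.mul he', fun k => ?_⟩
  simp only [hu, hv]; ring

theorem exists_norm_pow_sub_one {z : ℂ} (hz : ∀ k : ℕ, z ^ (k + 1) ≠ 1) :
    ∃ ρ : ℝ, 0 < ρ ∧ AsympAP fun k => ‖z ^ (k + 1) - 1‖ / ρ ^ (k + 1) := by
  rcases lt_trichotomy ‖z‖ 1 with h | h | h
  · refine ⟨1, one_pos, asympAP_of_tendsto_one ?_⟩
    have h1 : Tendsto (fun k : ℕ => z ^ (k + 1)) atTop (𝓝 0) :=
      (tendsto_pow_atTop_nhds_zero_of_norm_lt_one h).comp (tendsto_add_atTop_nat 1)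
    simpa using (h1.sub_const 1).norm
  · refine ⟨1, one_pos, ?_⟩
    simpa using (BohrAP.norm_pow_sub_one h).asympAP fun k =>
      norm_pos_iff.2 (sub_ne_zero.2 (hz k))
  · refine ⟨‖z‖, by linarith, asympAP_of_tendsto_one ?_⟩
    have hz0 : z ≠ 0 := norm_pos_iff.1 (by linarith)
    have hinv : ‖z⁻¹‖ < 1 := by rw [norm_inv]; exact inv_lt_one_of_one_lt₀ h
    have h1 : Tendsto (fun k : ℕ => z⁻¹ ^ (k + 1)) atTop (𝓝 0) :=
      (tendsto_pow_atTop_nhds_zero_of_norm_lt_one hinv).comp (tendsto_add_atTop_nat 1)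
    have h2 := (h1.const_sub 1).norm
    simp only [sub_zero, norm_one] at h2
    refine h2.congr fun k => ?_
    rw [← norm_pow, ← norm_div, sub_div, div_self (pow_ne_zero _ hz0), inv_pow, one_div]

theorem exists_prod_norm_pow_sub_one (M : Multiset ℂ) (hM : ∀ z ∈ M, ∀ k : ℕ, z ^ (k + 1) ≠ 1) :
    ∃ ρ : ℝ, 0 < ρ ∧
      AsympAP fun k => (M.map fun z => ‖z ^ (k + 1) - 1‖).prod / ρ ^ (k + 1) := by
  induction M using Multiset.induction_on with
  | empty =>
    refine ⟨1, one_pos, ?_⟩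
    simpa using asympAP_of_tendsto_one (tendsto_const_nhds (x := (1 : ℝ)))
  | cons z M ih =>
    obtain ⟨ρ, hρ, h⟩ := ih fun w hw => hM w (Multiset.mem_cons_of_mem hw)
    obtain ⟨ρ', hρ', h'⟩ := exists_norm_pow_sub_one (hM z (Multiset.mem_cons_self z M))
    refine ⟨ρ' * ρ, mul_pos hρ' hρ, ?_⟩
    convert h'.mul h using 2 with k
    rw [Multiset.map_cons, Multiset.prod_cons, mul_pow, mul_div_mul_comm]

theorem exists_mean_pos {u : ℕ → ℝ} (hu : AsympAP u) :
    ∃ B : ℝ, 0 < B ∧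
      Tendsto (fun X : ℕ => (∑ k ∈ Finset.range X, u k) / (X : ℝ)) atTop (𝓝 B) := by
  obtain ⟨b, e, hb, hb0, he, hu⟩ := hu
  obtain ⟨B, hB⟩ := hb.exists_mean
  obtain ⟨C, hC0, hC⟩ := hb.bounded
  refine ⟨B, hb.mean_pos (fun k => (hb0 k).le) (hb0 0) hB, ?_⟩
  have h1 : Tendsto (fun k => b k * (e k - 1)) atTop (𝓝 0) := by
    have : Tendsto (fun k => C * |e k - 1|) atTop (𝓝 0) := by
      simpa using ((he.sub_const 1).abs).const_mul C
    refine squeeze_zero_norm (fun k => ?_) this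
    rw [Real.norm_eq_abs, abs_mul]
    exact mul_le_mul_of_nonneg_right (hC k) (abs_nonneg _)
  have h2 := hB.add h1.cesaro
  rw [add_zero] at h2
  refine h2.congr fun X => ?_
  rw [inv_mul_eq_div, ← add_div, ← Finset.sum_add_distrib]
  congr 1
  exact Finset.sum_congr rfl fun k _ => by rw [hu]; ring

theorem eventually_le {u : ℕ → ℝ} (hu : AsympAP u) :
    ∃ C : ℝ, ∀ᶠ k in atTop, 0 < u k ∧ u k ≤ C := by
  obtain ⟨b, e, hb, hb0, he, hu⟩ := hu
  obtain ⟨C, hC0, hC⟩ := hb.bounded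
  refine ⟨C * 2, ?_⟩
  filter_upwards [he.eventually_lt_const (show (1 : ℝ) < 2 by norm_num),
    he.eventually_const_lt (show (0 : ℝ) < 1 by norm_num)] with k h1 h2
  rw [hu]
  exact ⟨mul_pos (hb0 k) h2, mul_le_mul ((le_abs_self _).trans (hC k)) h1.le h2.le hC0.le⟩

theorem frequently_ge {u : ℕ → ℝ} (hu : AsympAP u) :
    ∃ c : ℝ, 0 < c ∧ ∃ᶠ k in atTop, c ≤ u k := by
  obtain ⟨b, e, hb, hb0, he, hu⟩ := hu
  obtain ⟨K, hK⟩ := hb.exists_recurrence (half_lt_self (hb0 0))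
  refine ⟨b 0 / 2 * (1 / 2), by have := hb0 0; positivity, ?_⟩
  have hfreq : ∃ᶠ k in atTop, b 0 / 2 ≤ b k :=
    frequently_atTop.2 fun m => let ⟨n, h1, _, h3⟩ := hK m; ⟨n, h1, h3⟩
  refine (hfreq.and_eventually
    (he.eventually_const_lt (show (1 / 2 : ℝ) < 1 by norm_num))).mono ?_
  rintro k ⟨h1, h2⟩
  rw [hu]
  exact mul_le_mul h1 h2.le (by norm_num) (hb0 k).le

end AsympAP

open Polynomial in
theorem Matrix.det_aeval_of_splits {n : ℕ} (A : Matrix (Fin n) (Fin n) ℂ) {q : ℂ[X]}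
    (hq : q.Monic) :
    (aeval A q).det = (A.charpoly.roots.map fun z => q.eval z).prod := by
  have hsp : q.Splits := IsAlgClosed.splits q
  have hdet : ∀ w : ℂ, (aeval A (X - C w)).det
      = (A.charpoly.roots.map fun z => z - w).prod := by
    intro w
    have h1 : aeval A (X - C w) = -(Matrix.scalar (Fin n) w - A) := by
      simp [Matrix.algebraMap_eq_diagonal]
    have h2 : A.charpoly.eval w = (A.charpoly.roots.map fun z => w - z).prod := by
      conv_lhs => rw [(IsAlgClosed.splits A.charpoly).eq_prod_roots_of_monic A.charpoly_monic]
      rw [eval_multiset_prod, Multiset.map_map]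
      simp
    rw [h1, Matrix.det_neg, ← Matrix.eval_charpoly, h2]
    have hc : Multiset.card A.charpoly.roots = Fintype.card (Fin n) := by
      rw [← (IsAlgClosed.splits A.charpoly).natDegree_eq_card_roots,
        Matrix.charpoly_natDegree_eq_dim]
    rw [← hc, ← Multiset.card_map (fun z => w - z), ← Multiset.prod_map_neg, Multiset.map_map]
    simp
  let φ : ℂ[X] →* ℂ := Matrix.detMonoidHom.comp (MonoidHomClass.toMonoidHom (aeval A))
  have hφ : ∀ P, φ P = (aeval A P).det := fun P => rfl
  rw [← hφ]
  conv_lhs => rw [hsp.eq_prod_roots_of_monic hq]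
  rw [map_multiset_prod, Multiset.map_map]
  simp only [Function.comp_def, hφ, hdet]
  rw [Multiset.prod_map_prod_map]
  congr 1
  refine Multiset.map_congr rfl fun z _ => ?_
  conv_rhs => rw [hsp.eq_prod_roots_of_monic hq]
  rw [eval_multiset_prod, Multiset.map_map]
  simp

theorem Matrix.abs_det_pow_sub_one {n : ℕ} (A : Matrix (Fin n) (Fin n) ℤ) (k : ℕ) :
    |(((A ^ (k + 1) - 1).det : ℤ) : ℝ)|
      = ((A.map (Int.castRingHom ℂ)).charpoly.roots.map fun z => ‖z ^ (k + 1) - 1‖).prod := by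
  have h := (A.map (Int.castRingHom ℂ)).det_aeval_of_splits
    (Polynomial.monic_X_pow_sub_C (1 : ℂ) k.succ_ne_zero)
  have h1 : (((A ^ (k + 1) - 1).det : ℤ) : ℂ)
      = ((A.map (Int.castRingHom ℂ)) ^ (k + 1) - 1).det := by
    have := (Int.castRingHom ℂ).map_det (A ^ (k + 1) - 1)
    rw [eq_intCast] at this
    rw [this]
    simp only [map_sub, map_pow, map_one]
    rfl
  have h2 : ‖(((A ^ (k + 1) - 1).det : ℤ) : ℂ)‖ = |(((A ^ (k + 1) - 1).det : ℤ) : ℝ)| := by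
    rw [Complex.norm_intCast]
  rw [← h2, h1]
  simp only [map_sub, map_pow, Polynomial.aeval_X, map_one, Polynomial.eval_sub,
    Polynomial.eval_pow, Polynomial.eval_X, Polynomial.eval_one, Nat.succ_eq_add_one] at h
  rw [h]
  exact (map_multiset_prod (normHom : ℂ →*₀ ℝ) _).trans (by rw [Multiset.map_map]; rfl)

theorem cauchySeq_fad_factor {p : ℕ} (hp : p.Prime) {s t : ℝ} (hs : 0 ≤ s) (ht : 0 ≤ t) :
    CauchySeq fun v : ℕ => (((p : ℝ) ^ v)⁻¹) ^ s * (p : ℝ) ^ (-t * (p : ℝ) ^ v) := by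
  have hp1 : (1 : ℝ) ≤ p := by exact_mod_cast hp.one_lt.le
  have hp0 : (0 : ℝ) < p := by linarith
  have hanti : Antitone fun v : ℕ =>
      (((p : ℝ) ^ v)⁻¹) ^ s * (p : ℝ) ^ (-t * (p : ℝ) ^ v) := by
    intro v w hvw
    have hpow : (p : ℝ) ^ v ≤ (p : ℝ) ^ w := pow_le_pow_right₀ hp1 hvw
    refine mul_le_mul ?_ ?_ (by positivity) (by positivity)
    · exact Real.rpow_le_rpow (by positivity) (inv_anti₀ (by positivity) hpow) hs
    · exact Real.rpow_le_rpow_of_exponent_le hp1 (by nlinarith)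
  refine (tendsto_atTop_ciInf hanti ⟨0, ?_⟩).cauchySeq
  rintro _ ⟨v, rfl⟩
  positivity

theorem bohrAP_fad_factor {p : ℕ} (hp : p.Prime) {s t : ℕ → ℝ}
    (hs : ∀ k, 0 ≤ s (k + 1)) (ht : ∀ k, 0 ≤ t (k + 1)) {a b : ℕ} (ha : 0 < a) (hb : 0 < b)
    (hsper : ∀ k, s (k + 1 + a) = s (k + 1)) (htper : ∀ k, t (k + 1 + b) = t (k + 1)) :
    BohrAP fun k => (((p : ℝ) ^ padicValNat p (k + 1))⁻¹) ^ s (k + 1) *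
      (p : ℝ) ^ (-t (k + 1) * (p : ℝ) ^ padicValNat p (k + 1)) := by
  have hs' : Function.Periodic (fun k => s (k + 1)) a := fun k => by
    simp only [← hsper k]; congr 1; ring
  have ht' : Function.Periodic (fun k => t (k + 1)) b := fun k => by
    simp only [← htper k]; congr 1; ring
  refine BohrAP.of_padicValNat hp (q := a * b)
    (F := fun k v => (((p : ℝ) ^ v)⁻¹) ^ s (k + 1) * (p : ℝ) ^ (-t (k + 1) * (p : ℝ) ^ v))
    (Nat.mul_pos ha hb) (fun k v => ?_) fun k => cauchySeq_fad_factor hp (hs k) (ht k)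
  have e1 : s (k + a * b + 1) = s (k + 1) := by rw [mul_comm]; exact hs'.nat_mul b k
  have e2 : t (k + a * b + 1) = t (k + 1) := ht'.nat_mul a k
  simp only [e1, e2]

/-- If `σ_k = ρ ^ k * u_k` with `u` asymptotically almost periodic, the growth rate is `ρ`. -/
theorem limsup_growthSeq_eq {𝒳 : Type*} (σ : 𝒳 → 𝒳) {ρ : ℝ} (hρ : 0 < ρ)
    (hu : AsympAP fun k => (fixCount σ (k + 1) : ℝ) / ρ ^ (k + 1)) :
    limsup (growthSeq σ) atTop = ((Real.log ρ : ℝ) : EReal) := by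
  set u : ℕ → ℝ := fun k => (fixCount σ (k + 1) : ℝ) / ρ ^ (k + 1) with hu_def
  have hgrow : ∀ k, 0 < u k →
      growthSeq σ (k + 1) = ((Real.log ρ + Real.log (u k) / (k + 1 : ℕ) : ℝ) : EReal) := by
    intro k hk
    have hσ : (fixCount σ (k + 1) : ℝ) = ρ ^ (k + 1) * u k := by
      simp only [hu_def]; field_simp
    have hpos : 0 < ρ ^ (k + 1) * u k := by positivity
    rw [growthSeq, elog, hσ, if_neg hpos.not_ge, ← EReal.coe_mul,
      Real.log_mul (by positivity) hk.ne', Real.log_pow]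
    congr 1
    have : ((k + 1 : ℕ) : ℝ) ≠ 0 := by positivity
    field_simp
  have hlim : ∀ c : ℝ, Tendsto (fun k : ℕ =>
      ((Real.log ρ + Real.log c / (k + 1 : ℕ) : ℝ) : EReal)) atTop
      (𝓝 ((Real.log ρ : ℝ) : EReal)) := by
    intro c
    refine (continuous_coe_real_ereal.tendsto _).comp ?_
    have h := (tendsto_const_div_atTop_nhds_zero_nat (Real.log c)).comp (tendsto_add_atTop_nat 1)
    simpa using h.const_add (Real.log ρ)
  rw [← limsup_nat_add (growthSeq σ) 1]
  apply le_antisymm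
  · obtain ⟨C, hC⟩ := hu.eventually_le
    rw [← (hlim C).limsup_eq]
    refine limsup_le_limsup ?_
    filter_upwards [hC] with k hk
    rw [hgrow k hk.1]
    refine EReal.coe_le_coe_iff.2 ?_
    gcongr
    · exact hk.1
    · exact hk.2
  · obtain ⟨c, hc, hfreq⟩ := hu.frequently_ge
    refine le_of_forall_lt fun x hx => ?_
    obtain ⟨y, hxy, hy⟩ := exists_between hx
    refine hxy.trans_le (le_limsup_of_frequently_le' ?_)
    refine (hfreq.and_eventually ((hlim c).eventually_const_lt hy)).mono ?_
    rintro k ⟨h1, h2⟩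
    rw [hgrow k (hc.trans_le h1)]
    refine h2.le.trans (EReal.coe_le_coe_iff.2 ?_)
    gcongr

/-- Theorem C: a FAD-system (the gcd-sequence structure of `r`, `s`, `t` is recorded
through their periodicity, which is what the proof uses) with growth rate `Λ > 1` has
finite `Λ`, and the Cesàro mean `B = 𝒞(σ_k/Λ^k)` exists and is strictly positive. -/
theorem fad_cesaro_exists {𝒳 : Type*} (σ : 𝒳 → 𝒳) (hσ : Confined σ)
    (c : ℝ) (hc : 0 < c)
    (d : ℕ → ℝ)
    (hd : (∀ k, 1 ≤ k → d k = 1) ∨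
      ∃ (n : ℕ) (A : Matrix (Fin n) (Fin n) ℤ),
        ∀ k, 1 ≤ k → (A ^ k - 1).det ≠ 0 ∧ d k = |(((A ^ k - 1).det : ℤ) : ℝ)|)
    (S : Finset ℕ) (hS : ∀ p ∈ S, Nat.Prime p)
    (r : ℕ → ℝ) (hrpos : ∀ k, 1 ≤ k → 0 < r k)
    (ϖr : ℕ) (hϖr : 0 < ϖr) (hrper : ∀ k, 1 ≤ k → r (k + ϖr) = r k)
    (s t : ℕ → ℕ → ℝ)
    (hs0 : ∀ p ∈ S, ∀ k, 1 ≤ k → 0 ≤ s p k) (ht0 : ∀ p ∈ S, ∀ k, 1 ≤ k → 0 ≤ t p k)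
    (ϖs ϖt : ℕ → ℕ)
    (hϖs : ∀ p ∈ S, 0 < ϖs p ∧ Nat.Coprime (ϖs p) p ∧
      ∀ k, 1 ≤ k → s p (k + ϖs p) = s p k)
    (hϖt : ∀ p ∈ S, 0 < ϖt p ∧ Nat.Coprime (ϖt p) p ∧
      ∀ k, 1 ≤ k → t p (k + ϖt p) = t p k)
    (hFAD : ∀ k, 1 ≤ k →
      (fixCount σ k : ℝ) = c ^ k * d k * r k *
        ∏ p ∈ S, ((((p : ℝ) ^ padicValNat p k)⁻¹) ^ (s p k) *
          (p : ℝ) ^ (-(t p k) * (p : ℝ) ^ padicValNat p k)))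
    (hgrowth : 0 < Filter.limsup (growthSeq σ) atTop) :
    ∃ L : ℝ, Filter.limsup (growthSeq σ) atTop = ((L : ℝ) : EReal) ∧
      ∃ B : ℝ, 0 < B ∧
        CesaroLim (fun k => (fixCount σ k : ℝ) / Real.exp L ^ k) B := by
  have hd' : ∃ M : Multiset ℂ, (∀ z ∈ M, ∀ k : ℕ, z ^ (k + 1) ≠ 1) ∧
      ∀ k : ℕ, d (k + 1) = (M.map fun z => ‖z ^ (k + 1) - 1‖).prod := by
    rcases hd with hd | ⟨n, A, hA⟩
    · exact ⟨0, by simp, fun k => by simpa using hd (k + 1) (by omega)⟩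
    · have hdet : ∀ k : ℕ, d (k + 1) = ((A.map (Int.castRingHom ℂ)).charpoly.roots.map
          fun z => ‖z ^ (k + 1) - 1‖).prod := fun k => by
        rw [(hA (k + 1) (by omega)).2, Matrix.abs_det_pow_sub_one]
      refine ⟨_, fun z hz k hzk => (hA (k + 1) (by omega)).1 ?_, hdet⟩
      have h0 : d (k + 1) = 0 := by
        rw [hdet k]
        exact Multiset.prod_eq_zero (Multiset.mem_map.2 ⟨z, hz, by simp [hzk]⟩)
      rw [(hA (k + 1) (by omega)).2] at h0
      exact_mod_cast abs_eq_zero.1 h0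
  obtain ⟨M, hM, hdM⟩ := hd'
  obtain ⟨ρ, hρ, hρM⟩ := AsympAP.exists_prod_norm_pow_sub_one M hM
  have hr : AsympAP fun k => r (k + 1) :=
    (BohrAP.of_periodic hϖr fun k => by
      rw [← hrper (k + 1) (by omega)]; congr 1; ring).asympAP fun k => hrpos _ (by omega)
  have hprod := (BohrAP.prod S fun p hp => bohrAP_fad_factor (hS p hp)
    (fun k => hs0 p hp (k + 1) (by omega)) (fun k => ht0 p hp (k + 1) (by omega))
    (hϖs p hp).1 (hϖt p hp).1 (fun k => (hϖs p hp).2.2 (k + 1) (by omega))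
    (fun k => (hϖt p hp).2.2 (k + 1) (by omega))).asympAP fun k =>
      Finset.prod_pos fun p hp => by
        have : (0 : ℝ) < p := by exact_mod_cast (hS p hp).pos
        positivity
  have hcρ : 0 < c * ρ := mul_pos hc hρ
  have hu : AsympAP fun k => (fixCount σ (k + 1) : ℝ) / (c * ρ) ^ (k + 1) := by
    convert (hρM.mul hr).mul hprod using 2 with k
    rw [hFAD (k + 1) (by omega), hdM k, mul_pow]
    field_simp
  refine ⟨Real.log (c * ρ), limsup_growthSeq_eq σ hcρ hu, ?_⟩
  obtain ⟨B, hB, hlim⟩ := hu.exists_mean_pos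
  refine ⟨B, hB, hlim.congr fun X => ?_⟩
  rw [Real.exp_log hcρ, ← Finset.Ico_add_one_right_eq_Icc, Finset.sum_Ico_eq_sum_range]
  simp only [Nat.add_sub_cancel, add_comm 1]
end
end
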